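/- Let k, l be positive integers and u, w, x, z ∈ S_∞ with u ≤_k w and x ≤_l z, and suppose w∘u^{-1} is shape equivalent to z∘x^{-1}. Then there is an order isomorphism Φ from [u,w]_k := {v : u ≤_k v ≤_k w} (ordered by ≤_k) onto [x,z]_l := {v : x ≤_l v ≤_l z} (ordered by ≤_l), i.e., a bijection Φ with v ≤_k v' if and only if Φ(v) ≤_l Φ(v') for all v, v' ∈ [u,w]_k. Moreover, when w∘u^{-1} = z∘x^{-1}, the map Φ(v) = v∘u^{-1}∘x is such an isomorphism. -/

import Mathlib

/-- `S_∞`: a permutation of the positive integers lies in `S_∞` iff it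
fixes all but finitely many integers. -/
def finSupp (w : Equiv.Perm ℕ+) : Prop := {i : ℕ+ | w i ≠ i}.Finite

/-- The length `ℓ(w) = #{(i,j) : i < j and w(i) > w(j)}`. -/
noncomputable def len (w : Equiv.Perm ℕ+) : ℕ :=
  {p : ℕ+ × ℕ+ | p.1 < p.2 ∧ w p.2 < w p.1}.ncard

/-- Cover relation of the `k`-Bruhat order: `w = u∘(a,b)` with `a ≤ k < b`
and `ℓ(w) = ℓ(u) + 1`. -/
def kBruhatCover (k : ℕ) (u w : Equiv.Perm ℕ+) : Prop :=
  ∃ a b : ℕ+, (a : ℕ) ≤ k ∧ k < (b : ℕ) ∧ w = u * Equiv.swap a b ∧ len w = len u + 1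

/-- The `k`-Bruhat order `≤_k`: reflexive–transitive closure of the cover relation. -/
def kBruhatLE (k : ℕ) : Equiv.Perm ℕ+ → Equiv.Perm ℕ+ → Prop :=
  Relation.ReflTransGen (kBruhatCover k)

/-- `isPhi p ζ φ` says that `φ = φ_P(ζ)` where `P` is the range of the strictly
monotone enumeration `p`: `φ` fixes everything outside `P` and `φ(p_i) = p_{ζ(i)}`. -/
def isPhi (p : ℕ+ → ℕ+) (ζ φ : Equiv.Perm ℕ+) : Prop :=
  (∀ i, φ (p i) = p (ζ i)) ∧ ∀ x : ℕ+, x ∉ Set.range p → φ x = x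

theorem finSupp_mul_swap {u : Equiv.Perm ℕ+} (hu : finSupp u) (a b : ℕ+) :
    finSupp (u * Equiv.swap a b) := by
  refine (hu.union (Set.toFinite {a, b})).subset fun i hi => ?_
  by_contra h
  simp only [Set.mem_union, Set.mem_ofPred_eq, Set.mem_insert_iff, Set.mem_singleton_iff,
    not_or, not_not] at h
  exact hi (by rw [Equiv.Perm.mul_apply, Equiv.swap_apply_of_ne_of_ne h.2.1 h.2.2, h.1])

theorem eq_or_apply_lt_or_apply_lt (u : Equiv.Perm ℕ+) (i j : ℕ+) :
    i = j ∨ u i < u j ∨ u j < u i := by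
  rcases lt_trichotomy (u i) (u j) with h | h | h
  · exact Or.inr (Or.inl h)
  · exact Or.inl (u.injective h)
  · exact Or.inr (Or.inr h)

/-- The set of inversions of a permutation. -/
def inversions (w : Equiv.Perm ℕ+) : Set (ℕ+ × ℕ+) := {p | p.1 < p.2 ∧ w p.2 < w p.1}

theorem finite_inversions {u : Equiv.Perm ℕ+} (hu : finSupp u) : (inversions u).Finite := by
  obtain ⟨N, hN⟩ := hu.bddAbove
  have fix : ∀ i, N < i → u i = i := fun i hi => by
    by_contra h
    exact absurd (hN h) (not_le.2 hi)
  refine ((Set.finite_Iic N).prod (Set.finite_Iic N)).subset ?_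
  rintro ⟨i, j⟩ ⟨hij, h⟩
  dsimp only at hij h
  have hj : j ≤ N := by
    by_contra hj
    push Not at hj
    rw [fix j hj] at h
    have h1 := u.injective (fix _ (hj.trans h))
    exact absurd (h1 ▸ h) (not_lt.2 hij.le)
  exact ⟨hij.le.trans hj, hj⟩

/-- The involution on increasing pairs which applies the transposition `(a, b)` to both entries
unless this breaks the order of the pair. -/
def swapPair (a b : ℕ+) (p : ℕ+ × ℕ+) : ℕ+ × ℕ+ :=
  if Equiv.swap a b p.1 < Equiv.swap a b p.2 then (Equiv.swap a b p.1, Equiv.swap a b p.2) else p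

theorem swapPair_swapPair (a b : ℕ+) {p : ℕ+ × ℕ+} (hp : p.1 < p.2) :
    swapPair a b (swapPair a b p) = p := by
  by_cases h : Equiv.swap a b p.1 < Equiv.swap a b p.2 <;> simp [swapPair, h, hp]

theorem swapPair_mem {u : Equiv.Perm ℕ+} {a b : ℕ+} (hab : a < b) (h : u a < u b)
    {p : ℕ+ × ℕ+} (hp : p ∈ inversions u) :
    swapPair a b p ∈ inversions (u * Equiv.swap a b) \ {(a, b)} := by
  obtain ⟨i, j⟩ := p
  obtain ⟨hij, hu⟩ := hp
  simp only [swapPair, inversions, Set.mem_sdiff, Set.mem_ofPred_eq, Set.mem_singleton_iff,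
    Equiv.Perm.mul_apply, Equiv.swap_apply_def] at *
  grind

theorem injOn_swapPair (u : Equiv.Perm ℕ+) (a b : ℕ+) :
    Set.InjOn (swapPair a b) (inversions u) := fun p hp q hq h => by
  rw [← swapPair_swapPair a b hp.1, h, swapPair_swapPair a b hq.1]

theorem len_lt_len_mul_swap {u : Equiv.Perm ℕ+} (hu : finSupp u) {a b : ℕ+} (hab : a < b)
    (h : u a < u b) : len u < len (u * Equiv.swap a b) := by
  have hf := finite_inversions (finSupp_mul_swap hu a b)
  have h1 : (swapPair a b '' inversions u).ncard = len u :=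
    (injOn_swapPair u a b).ncard_image
  rw [← h1]
  refine Set.ncard_lt_ncard ((Set.ssubset_iff_of_subset ?_).2 ⟨(a, b), ?_, ?_⟩) hf
  · rintro _ ⟨p, hp, rfl⟩
    exact (swapPair_mem hab h hp).1
  · simpa using ⟨hab, h⟩
  · rintro ⟨p, hp, e⟩
    exact (swapPair_mem hab h hp).2 e

theorem len_mul_swap_of_forall {u : Equiv.Perm ℕ+} (hu : finSupp u) {a b : ℕ+} (hab : a < b)
    (h : u a < u b) (hc : ∀ c, a < c → c < b → u a < u c → ¬ u c < u b) :
    len (u * Equiv.swap a b) = len u + 1 := by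
  have h1 : (swapPair a b '' inversions u).ncard = len u :=
    (injOn_swapPair u a b).ncard_image
  have h2 : inversions (u * Equiv.swap a b) = insert (a, b) (swapPair a b '' inversions u) := by
    ext p
    constructor
    · intro hp
      by_cases hpab : p = (a, b)
      · exact Or.inl hpab
      · refine Or.inr ⟨swapPair a b p, ?_, swapPair_swapPair a b hp.1⟩
        obtain ⟨i, j⟩ := p
        obtain ⟨hij, hu⟩ := hp
        have hci := hc i
        have hcj := hc j
        have e := eq_or_apply_lt_or_apply_lt u
        have e1 := e i a
        have e2 := e i b
        have e3 := e j a
        have e4 := e j b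
        clear h1 hc e
        simp only [swapPair, inversions, Set.mem_ofPred_eq,
          Equiv.Perm.mul_apply, Equiv.swap_apply_def] at *
        by_cases h1 : i = a <;> by_cases h2 : i = b <;> by_cases h3 : j = a <;>
          by_cases h4 : j = b <;> simp only [h1, h2, h3, h4, if_true, if_false] at * <;>
        grind
    · rintro (rfl | ⟨p, hp, rfl⟩)
      · exact ⟨hab, by simpa using h⟩
      · exact (swapPair_mem hab h hp).1
  change (inversions _).ncard = _
  rw [h2, Set.ncard_insert_of_notMem _ ((finite_inversions hu).image _), h1]
  rintro ⟨p, hp, e⟩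
  exact (swapPair_mem hab h hp).2 e

theorem not_between_of_len_mul_swap {u : Equiv.Perm ℕ+} (hu : finSupp u) {a b : ℕ+} (hab : a < b)
    (h : u a < u b) (hl : len (u * Equiv.swap a b) = len u + 1) (c : ℕ+) (hac : a < c)
    (hcb : c < b) (h1 : u a < u c) : ¬ u c < u b := by
  intro h2
  have hf := finite_inversions (finSupp_mul_swap hu a b)
  have hn : ∀ q ∈ ({(a, b), (a, c)} : Set (ℕ+ × ℕ+)), q ∉ swapPair a b '' inversions u := by
    rintro _ (rfl | rfl) ⟨p, hp, e⟩
    · exact (swapPair_mem hab h hp).2 e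
    · have := swapPair_swapPair a b hp.1
      rw [e] at this
      have hs : swapPair a b (a, c) = (a, c) := by
        simp [swapPair, Equiv.swap_apply_of_ne_of_ne hac.ne' hcb.ne, hcb.le]
      rw [hs] at this
      subst this
      exact absurd hp.2 (not_lt.2 h1.le)
  have hs : swapPair a b '' inversions u ∪ {(a, b), (a, c)} ⊆
      inversions (u * Equiv.swap a b) := by
    rintro _ (⟨p, hp, rfl⟩ | rfl | rfl)
    · exact (swapPair_mem hab h hp).1
    · exact ⟨hab, by simpa using h⟩
    · exact ⟨hac, by
        simpa [Equiv.swap_apply_of_ne_of_ne hac.ne' hcb.ne] using h2⟩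
  have h3 := Set.ncard_le_ncard hs hf
  rw [Set.ncard_union_eq (Set.disjoint_right.2 hn) ((finite_inversions hu).image _)
    (Set.toFinite _), (injOn_swapPair u a b).ncard_image,
    Set.ncard_pair (by simpa using hcb.ne')] at h3
  change len u + 2 ≤ len _ at h3
  omega

theorem lt_of_kBruhatCover {u : Equiv.Perm ℕ+} (hu : finSupp u) {a b : ℕ+} (hab : a < b)
    (hl : len (u * Equiv.swap a b) = len u + 1) : u a < u b := by
  by_contra h
  have h' : u b < u a := lt_of_le_of_ne (not_lt.1 h) fun e => hab.ne' (u.injective e)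
  have := len_lt_len_mul_swap (finSupp_mul_swap hu a b) hab (by simpa using h')
  rw [mul_assoc, Equiv.swap_mul_self, mul_one] at this
  omega

/-- The characterization of the `k`-Bruhat order by comparing values. -/
def bruhatCriterion (k : ℕ) (u w : Equiv.Perm ℕ+) : Prop :=
  (∀ a : ℕ+, (a : ℕ) ≤ k → u a ≤ w a) ∧ (∀ b : ℕ+, k < (b : ℕ) → w b ≤ u b) ∧
    ∀ a b : ℕ+, a < b → ((a : ℕ) ≤ k ↔ (b : ℕ) ≤ k) → u a < u b → w a < w b

theorem bruhatCriterion_of_cover {k : ℕ} {u w : Equiv.Perm ℕ+} (hu : finSupp u)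
    (h : kBruhatCover k u w) : bruhatCriterion k u w ∧ finSupp w := by
  obtain ⟨a, b, ha, hb, rfl, hl⟩ := h
  have hab : a < b := by
    rw [← PNat.coe_lt_coe]
    omega
  have h := lt_of_kBruhatCover hu hab hl
  have hc := not_between_of_len_mul_swap hu hab h hl
  refine ⟨⟨fun c hck => ?_, fun c hck => ?_, fun c d hcd hs hlt => ?_⟩, finSupp_mul_swap hu a b⟩
  · simp only [Equiv.Perm.mul_apply, Equiv.swap_apply_def]
    grind
  · simp only [Equiv.Perm.mul_apply, Equiv.swap_apply_def]
    grind
  · have hcc := hc c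
    have hcd' := hc d
    have e1 := eq_or_apply_lt_or_apply_lt u c b
    have e2 := eq_or_apply_lt_or_apply_lt u d b
    have e3 := eq_or_apply_lt_or_apply_lt u c a
    have e4 := eq_or_apply_lt_or_apply_lt u d a
    rw [← PNat.coe_lt_coe] at hcd hab
    simp only [← PNat.coe_lt_coe a, ← PNat.coe_lt_coe _ b] at hcc hcd'
    simp only [Equiv.Perm.mul_apply, Equiv.swap_apply_def]
    grind

theorem bruhatCriterion_of_kBruhatLE {k : ℕ} {u w : Equiv.Perm ℕ+} (hu : finSupp u)
    (h : kBruhatLE k u w) : bruhatCriterion k u w ∧ finSupp w := by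
  induction h with
  | refl => exact ⟨⟨fun _ _ => le_rfl, fun _ _ => le_rfl, fun _ _ _ _ h => h⟩, hu⟩
  | tail _ h ih =>
    obtain ⟨⟨h1, h2, h3⟩, hv⟩ := ih
    obtain ⟨⟨g1, g2, g3⟩, hw⟩ := bruhatCriterion_of_cover hv h
    exact ⟨⟨fun a ha => (h1 a ha).trans (g1 a ha), fun b hb => (g2 b hb).trans (h2 b hb),
      fun a b hab hs hlt => g3 a b hab hs (h3 a b hab hs hlt)⟩, hw⟩

theorem perm_eq_of_le {u w : Equiv.Perm ℕ+} (h : ∀ a, w a ≤ u a) : w = u := by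
  have key : ∀ t, w (u.symm t) = t := by
    intro t
    induction t using PNat.strongInductionOn with
    | _ t ih =>
      have h1 : w (u.symm t) ≤ t := by simpa using h (u.symm t)
      rcases h1.lt_or_eq with h2 | h2
      · have h3 := u.symm.injective (w.injective (ih _ h2))
        exact h3
      · exact h2
  ext a
  simpa using congrArg PNat.val (key (u a))

theorem exists_crossing {k : ℕ} {u w : Equiv.Perm ℕ+} (h : bruhatCriterion k u w) {a : ℕ+}
    (hak : (a : ℕ) ≤ k)
    (hmax : ∀ c : ℕ+, (c : ℕ) ≤ k → u a < u c → w c = u c) (t : ℕ+) :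
    ∀ e, w e = t → u a < t → t ≤ w a → (e = a ∨ k < (e : ℕ) ∧ w e < u e) →
      ∃ b : ℕ+, k < (b : ℕ) ∧ w b ≤ u a ∧ u a < u b ∧ u b ≤ w a := by
  induction t using PNat.strongInductionOn with
  | _ t ih =>
    intro e he hat hta hcase
    obtain ⟨c, hc⟩ := u.surjective t
    by_cases hck : (c : ℕ) ≤ k
    · have h1 := hmax c hck (hc ▸ hat)
      have : c = e := w.injective (by rw [h1, hc, he])
      subst this
      rcases hcase with rfl | ⟨h2, _⟩
      · exact absurd hc hat.ne
      · omega
    · push Not at hck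
      have h1 : w c < t := by
        refine lt_of_le_of_ne (hc ▸ h.2.1 c hck) fun h2 => ?_
        have : c = e := w.injective (by rw [h2, he])
        subst this
        rcases hcase with rfl | ⟨_, h3⟩
        · omega
        · exact absurd (he.trans hc.symm) h3.ne
      by_cases h2 : w c ≤ u a
      · exact ⟨c, hck, h2, hc ▸ hat, hc ▸ hta⟩
      · exact ih (w c) h1 c rfl (not_le.1 h2) (h1.le.trans hta) (Or.inr ⟨hck, hc ▸ h1⟩)

theorem exists_cover_of_bruhatCriterion {k : ℕ} {u w : Equiv.Perm ℕ+} (hu : finSupp u)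
    (h : bruhatCriterion k u w) (hne : u ≠ w) :
    ∃ a b : ℕ+, (a : ℕ) ≤ k ∧ k < (b : ℕ) ∧ u a < u b ∧
      kBruhatCover k u (u * Equiv.swap a b) ∧ bruhatCriterion k (u * Equiv.swap a b) w := by
  have hfin : {a : ℕ+ | (a : ℕ) ≤ k ∧ u a < w a}.Finite :=
    ((Set.finite_Iic k).preimage PNat.coe_injective.injOn).subset fun a ha => ha.1
  have hnon : {a : ℕ+ | (a : ℕ) ≤ k ∧ u a < w a}.Nonempty := by
    by_contra hem
    refine hne (perm_eq_of_le (w := w) fun a => ?_).symm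
    by_cases hak : (a : ℕ) ≤ k
    · exact not_lt.1 fun hlt => hem ⟨a, hak, hlt⟩
    · exact h.2.1 a (not_le.1 hak)
  obtain ⟨a, ⟨hak, haw⟩, hamax⟩ := Set.exists_max_image _ u hfin hnon
  have hmax : ∀ c : ℕ+, (c : ℕ) ≤ k → u a < u c → w c = u c := fun c hck hlt =>
    le_antisymm (not_lt.1 fun h1 => absurd (hamax c ⟨hck, h1⟩) (not_le.2 hlt)) (h.1 c hck)
  obtain ⟨b, ⟨hbk, hwb, hab, hba⟩, hbmin⟩ := WellFounded.has_min (measure fun b => (u b : ℕ)).wf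
    {b : ℕ+ | k < (b : ℕ) ∧ w b ≤ u a ∧ u a < u b ∧ u b ≤ w a}
    (exists_crossing h hak hmax _ a rfl haw le_rfl (Or.inl rfl))
  have hmin : ∀ d : ℕ+, k < (d : ℕ) → w d ≤ u a → u a < u d → ¬ u d < u b :=
    fun d h1 h2 h3 h4 => hbmin d ⟨h1, h2, h3, h4.le.trans hba⟩ h4
  have hlt : a < b := by
    rw [← PNat.coe_lt_coe]
    omega
  refine ⟨a, b, hak, hbk, hab, ⟨a, b, hak, hbk, rfl, len_mul_swap_of_forall hu hlt hab ?_⟩,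
    ?_, ?_, ?_⟩
  · intro c hac hcb h1 h2
    by_cases hck : (c : ℕ) ≤ k
    · have h3 := h.2.2 a c hac (by simp [hak, hck]) h1
      rw [hmax c hck h1] at h3
      exact absurd (h2.trans_le hba) h3.not_gt
    · have h3 := h.2.2 c b hcb (by simp [hck, hbk]) h2
      exact hmin c (not_le.1 hck) (h3.le.trans hwb) h1 h2
  · intro c hck
    have := h.1 c hck
    simp only [Equiv.Perm.mul_apply, Equiv.swap_apply_def]
    grind
  · intro c hck
    have := h.2.1 c hck
    simp only [Equiv.Perm.mul_apply, Equiv.swap_apply_def]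
    grind
  · intro c d hcd hs
    have h1 := h.2.2 c d hcd hs
    have h2 := hmax c
    have h3 := hmin d
    have e1 := eq_or_apply_lt_or_apply_lt u c a
    have e2 := eq_or_apply_lt_or_apply_lt u d b
    have e3 := eq_or_apply_lt_or_apply_lt w d b
    simp only [Equiv.Perm.mul_apply, Equiv.swap_apply_def]
    clear hmax hmin hamax hbmin h hfin hnon
    rw [← PNat.coe_lt_coe] at hcd
    grind

theorem kBruhatLE_of_bruhatCriterion {k : ℕ} {w : Equiv.Perm ℕ+} (n : ℕ) :
    ∀ u : Equiv.Perm ℕ+, finSupp u → bruhatCriterion k u w →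
      ∑ a ∈ Finset.Icc (1 : ℕ) k, ((w a.toPNat' : ℕ) - (u a.toPNat' : ℕ)) = n →
      kBruhatLE k u w := by
  induction n using Nat.strong_induction_on with
  | _ n ih =>
    intro u hu h hn
    by_cases hne : u = w
    · subst hne
      exact Relation.ReflTransGen.refl
    obtain ⟨a, b, hak, hbk, hab, hcov, hcr⟩ := exists_cover_of_bruhatCriterion hu h hne
    refine Relation.ReflTransGen.head hcov
      (ih _ ?_ _ (finSupp_mul_swap hu a b) hcr rfl)
    have key : ∀ c : ℕ+, (c : ℕ) ≤ k → u c ≤ (u * Equiv.swap a b) c := by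
      intro c hck
      simp only [Equiv.Perm.mul_apply, Equiv.swap_apply_def]
      grind
    rw [← hn]
    refine Finset.sum_lt_sum (fun c hc => ?_) ⟨a, Finset.mem_Icc.2 ⟨a.2, hak⟩, ?_⟩
    · rw [Finset.mem_Icc] at hc
      have := key c.toPNat' (by
        rw [Nat.toPNat'_coe, if_pos (Nat.lt_of_lt_of_le one_pos hc.1)]
        exact hc.2)
      rw [← PNat.coe_le_coe] at this
      omega
    · have h1 := hcr.1 a hak
      simp only [Equiv.Perm.mul_apply, Equiv.swap_apply_left, PNat.coe_toPNat'] at h1 ⊢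
      rw [← PNat.coe_le_coe] at h1
      rw [← PNat.coe_lt_coe] at hab
      omega

theorem kBruhatLE_iff {k : ℕ} {u w : Equiv.Perm ℕ+} (hu : finSupp u) :
    kBruhatLE k u w ↔ bruhatCriterion k u w :=
  ⟨fun h => (bruhatCriterion_of_kBruhatLE hu h).1,
    fun h => kBruhatLE_of_bruhatCriterion _ u hu h rfl⟩

/-- Both points are moved up by `ζ`, or both are moved down. -/
def sameDirection (ζ : Equiv.Perm ℕ+) (i j : ℕ+) : Prop :=
  (i < ζ i ∧ j < ζ j) ∨ (ζ i < i ∧ ζ j < j)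

/-- The comparison of permutations in terms of the points moved up and down by `ζ`. -/
def intrinsicLE (ζ η η' : Equiv.Perm ℕ+) : Prop :=
  (∀ i, i < ζ i → η i ≤ η' i) ∧ (∀ i, ζ i < i → η' i ≤ η i) ∧
    ∀ i j, i < j → sameDirection ζ i j → η j < η i → η' j < η' i

/-- The permutations lying between the identity and `ζ`. -/
def intrinsicInterval (ζ : Equiv.Perm ℕ+) : Set (Equiv.Perm ℕ+) :=
  {η | intrinsicLE ζ 1 η ∧ intrinsicLE ζ η ζ ∧ ∀ i, ζ i = i → η i = i}

theorem one_mem_intrinsicInterval (ζ : Equiv.Perm ℕ+) : 1 ∈ intrinsicInterval ζ :=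
  ⟨⟨fun _ _ => le_rfl, fun _ _ => le_rfl, fun _ _ _ _ h => h⟩,
    ⟨fun _ h => h.le, fun _ h => h.le, fun _ _ h _ h' => absurd h h'.not_gt⟩, fun _ _ => rfl⟩

theorem self_mem_intrinsicInterval (ζ : Equiv.Perm ℕ+) : ζ ∈ intrinsicInterval ζ :=
  ⟨⟨fun _ h => h.le, fun _ h => h.le, fun _ _ h _ h' => absurd h h'.not_gt⟩,
    ⟨fun _ _ => le_rfl, fun _ _ => le_rfl, fun _ _ _ _ h => h⟩, fun _ h => h⟩

theorem intrinsicLE_of_bruhatCriterion {k : ℕ} {u ζ η η' : Equiv.Perm ℕ+}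
    (h : bruhatCriterion k u (ζ * u)) (h1 : bruhatCriterion k u (η * u))
    (h2 : bruhatCriterion k (η * u) (η' * u)) : intrinsicLE ζ η η' := by
  have up : ∀ i, i < ζ i → (u.symm i : ℕ) ≤ k := fun i hi => by
    by_contra hk
    have := h.2.1 (u.symm i) (not_le.1 hk)
    simp only [Equiv.Perm.mul_apply, Equiv.apply_symm_apply] at this
    exact absurd hi this.not_gt
  have down : ∀ i, ζ i < i → k < (u.symm i : ℕ) := fun i hi => by
    by_contra hk
    have := h.1 (u.symm i) (not_lt.1 hk)
    simp only [Equiv.Perm.mul_apply, Equiv.apply_symm_apply] at this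
    exact absurd hi this.not_gt
  refine ⟨fun i hi => ?_, fun i hi => ?_, fun i j hij hd hlt => ?_⟩
  · simpa using h2.1 _ (up i hi)
  · simpa using h2.2.1 _ (down i hi)
  · have hs : (u.symm i : ℕ) ≤ k ↔ (u.symm j : ℕ) ≤ k := by
      rcases hd with ⟨a, b⟩ | ⟨a, b⟩
      · exact iff_of_true (up i a) (up j b)
      · exact iff_of_false (down i a).not_ge (down j b).not_ge
    rcases lt_trichotomy (u.symm i) (u.symm j) with h3 | h3 | h3
    · have := h1.2.2 _ _ h3 hs (by simpa using hij)
      simp only [Equiv.Perm.mul_apply, Equiv.apply_symm_apply] at this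
      exact absurd hlt this.not_gt
    · exact absurd (u.symm.injective h3) hij.ne
    · simpa using h2.2.2 _ _ h3 hs.symm (by simpa using hlt)

theorem mem_intrinsicInterval_of_bruhatCriterion {k : ℕ} {u ζ η : Equiv.Perm ℕ+}
    (h : bruhatCriterion k u (ζ * u)) (h1 : bruhatCriterion k u (η * u))
    (h2 : bruhatCriterion k (η * u) (ζ * u)) : η ∈ intrinsicInterval ζ := by
  have h0 : bruhatCriterion k u (1 * u) :=
    ⟨fun _ _ => le_rfl, fun _ _ => le_rfl, fun _ _ _ _ h => h⟩
  refine ⟨intrinsicLE_of_bruhatCriterion h h0 h1, intrinsicLE_of_bruhatCriterion h h1 h2,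
    fun i hi => ?_⟩
  by_cases hk : (u.symm i : ℕ) ≤ k
  · have g1 := h1.1 _ hk
    have g2 := h2.1 _ hk
    simp only [Equiv.Perm.mul_apply, Equiv.apply_symm_apply, hi] at g1 g2
    exact le_antisymm g2 g1
  · have g1 := h1.2.1 _ (not_le.1 hk)
    have g2 := h2.2.1 _ (not_le.1 hk)
    simp only [Equiv.Perm.mul_apply, Equiv.apply_symm_apply, hi] at g1 g2
    exact le_antisymm g1 g2

theorem bruhatCriterion_of_intrinsicLE {k : ℕ} {u ζ η η' : Equiv.Perm ℕ+}
    (h : bruhatCriterion k u (ζ * u)) (h1 : η ∈ intrinsicInterval ζ)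
    (h2 : η' ∈ intrinsicInterval ζ) (h3 : intrinsicLE ζ η η') :
    bruhatCriterion k (η * u) (η' * u) := by
  have up : ∀ a : ℕ+, (a : ℕ) ≤ k → u a ≤ ζ (u a) := h.1
  have down : ∀ a : ℕ+, k < (a : ℕ) → ζ (u a) ≤ u a := h.2.1
  refine ⟨fun a ha => ?_, fun a ha => ?_, fun a b hab hs hlt => ?_⟩
  · rcases (up a ha).lt_or_eq with g | g
    · exact h3.1 _ g
    · simp [h1.2.2 _ g.symm, h2.2.2 _ g.symm]
  · rcases (down a ha).lt_or_eq with g | g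
    · exact h3.2.1 _ g
    · simp [h1.2.2 _ g, h2.2.2 _ g]
  · have g := h.2.2 a b hab hs
    simp only [Equiv.Perm.mul_apply] at hlt g ⊢
    have hne : u a ≠ u b := fun e => hab.ne (u.injective e)
    have hζ := eq_or_apply_lt_or_apply_lt ζ (u a) (u b)
    have hη := eq_or_apply_lt_or_apply_lt η' (u a) (u b)
    have hne' := hne.lt_or_gt
    have ua := up a
    have ub := up b
    have da := down a
    have db := down b
    generalize u a = i at *
    generalize u b = j at *
    obtain ⟨⟨a1, a2, a3⟩, ⟨a4, a5, a6⟩, a7⟩ := h1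
    obtain ⟨⟨b1, b2, b3⟩, ⟨b4, b5, b6⟩, b7⟩ := h2
    obtain ⟨c1, c2, c3⟩ := h3
    have b6' := b6 i j
    have c3' := c3 j i
    have hd : sameDirection ζ i j ∨ ζ i = i ∨ ζ j = j := by
      unfold sameDirection
      grind
    have hd' : sameDirection ζ i j → sameDirection ζ j i := by
      unfold sameDirection
      grind
    have a1i := a1 i
    have a1j := a1 j
    have a2i := a2 i
    have a2j := a2 j
    have a4i := a4 i
    have a4j := a4 j
    have a5i := a5 i
    have a5j := a5 j
    have a7i := a7 i
    have a7j := a7 j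
    have b1i := b1 i
    have b1j := b1 j
    have b2i := b2 i
    have b2j := b2 j
    have b4i := b4 i
    have b4j := b4 j
    have b5i := b5 i
    have b5j := b5 j
    have b7i := b7 i
    have b7j := b7 j
    have c1i := c1 i
    have c1j := c1 j
    have c2i := c2 i
    have c2j := c2 j
    clear a1 a2 a3 a4 a5 a6 a7 b1 b2 b3 b4 b5 b6 b7 c1 c2 c3 up down h
    simp only [Equiv.Perm.one_apply] at *
    grind

theorem finSupp_mul_of_forall {u ζ η : Equiv.Perm ℕ+} (hu : finSupp u) (hζ : finSupp (ζ * u))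
    (h : ∀ i, ζ i = i → η i = i) : finSupp (η * u) := by
  refine (hu.union hζ).subset fun i hi => ?_
  by_contra hc
  simp only [Set.mem_union, Set.mem_ofPred_eq, not_or, not_not, Equiv.Perm.mul_apply] at hc
  obtain ⟨h1, h2⟩ := hc
  rw [h1] at h2
  exact hi (by rw [Equiv.Perm.mul_apply, h1, h _ h2])

/-- The interval `[u, w]_k`. -/
def bruhatInterval (k : ℕ) (u w : Equiv.Perm ℕ+) : Set (Equiv.Perm ℕ+) :=
  {v | kBruhatLE k u v ∧ kBruhatLE k v w}

/-- `f` restricts to an isomorphism from `(S, r)` onto `(T, s)`. -/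
def IsIsoOn {α β : Type*} (f : α → β) (S : Set α) (r : α → α → Prop) (T : Set β)
    (s : β → β → Prop) : Prop :=
  Set.BijOn f S T ∧ ∀ v v', v ∈ S → v' ∈ S → (r v v' ↔ s (f v) (f v'))

theorem IsIsoOn.comp {α β γ : Type*} {g : β → γ} {f : α → β} {S : Set α} {T : Set β} {U : Set γ}
    {r : α → α → Prop} {s : β → β → Prop} {t : γ → γ → Prop} (hg : IsIsoOn g T s U t)
    (hf : IsIsoOn f S r T s) : IsIsoOn (g ∘ f) S r U t :=
  ⟨hg.1.comp hf.1, fun v v' hv hv' =>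
    (hf.2 v v' hv hv').trans (hg.2 _ _ (hf.1.mapsTo hv) (hf.1.mapsTo hv'))⟩

theorem IsIsoOn.of_invOn {α β : Type*} {g : β → α} {f : α → β} {S : Set α} {T : Set β}
    {r : α → α → Prop} {s : β → β → Prop} (hf : IsIsoOn f S r T s) (hg : Set.InvOn g f S T)
    (hm : Set.MapsTo g T S) : IsIsoOn g T s S r := by
  refine ⟨hg.symm.bijOn hm hf.1.mapsTo, fun v v' hv hv' => ?_⟩
  rw [hf.2 _ _ (hm hv) (hm hv'), hg.2 hv, hg.2 hv']

theorem IsIsoOn.exists_inv {α β : Type*} [Nonempty α] {f : α → β} {S : Set α} {T : Set β}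
    {r : α → α → Prop} {s : β → β → Prop} (hf : IsIsoOn f S r T s) :
    ∃ g, IsIsoOn g T s S r :=
  ⟨_, hf.of_invOn hf.1.invOn_invFunOn hf.1.surjOn.mapsTo_invFunOn⟩

theorem isIsoOn_bruhatInterval {k : ℕ} {u w : Equiv.Perm ℕ+} (hu : finSupp u)
    (huw : kBruhatLE k u w) :
    IsIsoOn (fun η => η * u) (intrinsicInterval (w * u⁻¹)) (intrinsicLE (w * u⁻¹))
      (bruhatInterval k u w) (kBruhatLE k) := by
  obtain ⟨h, hw⟩ := bruhatCriterion_of_kBruhatLE hu huw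
  obtain ⟨ζ, rfl⟩ : ∃ ζ, w = ζ * u := ⟨w * u⁻¹, by simp⟩
  simp only [mul_inv_cancel_right]
  have hfin : ∀ η ∈ intrinsicInterval ζ, finSupp (η * u) := fun η hη =>
    finSupp_mul_of_forall hu hw hη.2.2
  have hmaps : Set.MapsTo (fun η => η * u) (intrinsicInterval ζ) (bruhatInterval k u (ζ * u)) := by
    intro η hη
    refine ⟨(kBruhatLE_iff hu).2 ?_, (kBruhatLE_iff (hfin η hη)).2 ?_⟩
    · simpa using bruhatCriterion_of_intrinsicLE h (one_mem_intrinsicInterval ζ) hη hη.1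
    · exact bruhatCriterion_of_intrinsicLE h hη (self_mem_intrinsicInterval ζ) hη.2.1
  refine ⟨⟨hmaps, fun _ _ _ _ e => mul_right_cancel e, fun v hv => ⟨v * u⁻¹, ?_, by simp⟩⟩,
    fun η η' hη hη' => ?_⟩
  · obtain ⟨h1, hv'⟩ := bruhatCriterion_of_kBruhatLE hu hv.1
    have h2 := (kBruhatLE_iff hv').1 hv.2
    exact mem_intrinsicInterval_of_bruhatCriterion h (by simpa using h1) (by simpa using h2)
  · rw [kBruhatLE_iff (hfin η hη)]
    exact ⟨bruhatCriterion_of_intrinsicLE h hη hη', intrinsicLE_of_bruhatCriterion h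
      ((kBruhatLE_iff hu).1 (hmaps hη).1)⟩

theorem isIsoOn_mul_inv {k : ℕ} {u w : Equiv.Perm ℕ+} (hu : finSupp u)
    (huw : kBruhatLE k u w) :
    IsIsoOn (fun v => v * u⁻¹) (bruhatInterval k u w) (kBruhatLE k)
      (intrinsicInterval (w * u⁻¹)) (intrinsicLE (w * u⁻¹)) := by
  have h := isIsoOn_bruhatInterval hu huw
  refine h.of_invOn ⟨fun _ _ => by simp, fun _ _ => by simp⟩ fun v hv => ?_
  obtain ⟨η, hη, rfl⟩ := h.1.surjOn hv
  simpa using hη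

theorem isPhi_viaEmbedding (p : ℕ+ ↪ ℕ+) (θ : Equiv.Perm ℕ+) :
    isPhi p θ (θ.viaEmbedding p) :=
  ⟨fun i => Equiv.Perm.viaEmbedding_apply θ p i,
    fun x hx => Equiv.Perm.viaEmbedding_apply_of_notMem θ p x hx⟩

theorem exists_isPhi {p : ℕ+ → ℕ+} (hp : p.Injective) {η : Equiv.Perm ℕ+}
    (h : ∀ x, x ∉ Set.range p → η x = x) : ∃ θ, isPhi p θ η := by
  have h1 : ∀ i, ∃ j, p j = η (p i) := fun i => by
    by_contra hc
    have := η.injective (h _ hc)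
    exact hc ⟨i, this.symm⟩
  choose f hf using h1
  have hb : Function.Bijective f := by
    refine ⟨fun i j e => hp (η.injective (by rw [← hf, ← hf, e])), fun j => ?_⟩
    obtain ⟨x, hx⟩ := η.surjective (p j)
    by_cases hr : x ∈ Set.range p
    · obtain ⟨i, rfl⟩ := hr
      exact ⟨i, hp ((hf i).trans hx)⟩
    · rw [h x hr] at hx
      exact absurd ⟨j, hx.symm⟩ hr
  exact ⟨Equiv.ofBijective f hb, fun i => (hf i).symm, h⟩

theorem isPhi_unique {p : ℕ+ → ℕ+} {θ η η' : Equiv.Perm ℕ+} (h : isPhi p θ η)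
    (h' : isPhi p θ η') : η = η' := by
  refine Equiv.ext fun x => ?_
  by_cases hr : x ∈ Set.range p
  · obtain ⟨i, rfl⟩ := hr
    rw [h.1, h'.1]
  · rw [h.2 x hr, h'.2 x hr]

theorem intrinsicLE_iff_of_isPhi {p : ℕ+ → ℕ+} (hp : StrictMono p)
    {ξ ζ θ η θ' η' : Equiv.Perm ℕ+} (hζ : isPhi p ξ ζ) (h : isPhi p θ η) (h' : isPhi p θ' η') :
    intrinsicLE ξ θ θ' ↔ intrinsicLE ζ η η' := by
  have up : ∀ x, x < ζ x → ∃ i, p i = x := fun x hx => by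
    by_contra hc
    exact hx.ne (hζ.2 x hc).symm
  have down : ∀ x, ζ x < x → ∃ i, p i = x := fun x hx => by
    by_contra hc
    exact hx.ne (hζ.2 x hc)
  constructor
  · rintro ⟨h1, h2, h3⟩
    refine ⟨fun x hx => ?_, fun x hx => ?_, fun x y hxy hd => ?_⟩
    · obtain ⟨i, rfl⟩ := up x hx
      rw [hζ.1, hp.lt_iff_lt] at hx
      rw [h.1, h'.1, hp.le_iff_le]
      exact h1 i hx
    · obtain ⟨i, rfl⟩ := down x hx
      rw [hζ.1, hp.lt_iff_lt] at hx
      rw [h.1, h'.1, hp.le_iff_le]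
      exact h2 i hx
    · obtain ⟨i, rfl⟩ : ∃ i, p i = x := hd.elim (fun h => up x h.1) fun h => down x h.1
      obtain ⟨j, rfl⟩ : ∃ i, p i = y := hd.elim (fun h => up y h.2) fun h => down y h.2
      simp only [sameDirection, hζ.1, h.1, h'.1, hp.lt_iff_lt] at hd hxy ⊢
      exact h3 i j hxy hd
  · rintro ⟨h1, h2, h3⟩
    refine ⟨fun i hi => ?_, fun i hi => ?_, fun i j hij hd => ?_⟩
    · simpa only [hζ.1, h.1, h'.1, hp.lt_iff_lt, hp.le_iff_le, hi, forall_const] using h1 (p i)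
    · simpa only [hζ.1, h.1, h'.1, hp.lt_iff_lt, hp.le_iff_le, hi, forall_const] using h2 (p i)
    · have := h3 (p i) (p j)
      simp only [sameDirection, hζ.1, h.1, h'.1, hp.lt_iff_lt] at this
      exact this hij hd

theorem mem_intrinsicInterval_iff_of_isPhi {p : ℕ+ → ℕ+} (hp : StrictMono p)
    {ξ ζ θ η : Equiv.Perm ℕ+} (hζ : isPhi p ξ ζ) (h : isPhi p θ η) :
    θ ∈ intrinsicInterval ξ ↔ η ∈ intrinsicInterval ζ := by
  have h1 : isPhi p 1 1 := ⟨fun _ => rfl, fun _ _ => rfl⟩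
  refine and_congr (intrinsicLE_iff_of_isPhi hp hζ h1 h)
    (and_congr (intrinsicLE_iff_of_isPhi hp hζ h hζ) ⟨fun g x hx => ?_, fun g i hi => ?_⟩)
  · by_cases hr : x ∈ Set.range p
    · obtain ⟨i, rfl⟩ := hr
      rw [h.1, g i (hp.injective (by rw [← hζ.1, hx]))]
    · exact h.2 x hr
  · exact hp.injective (by rw [← h.1, g (p i) (by rw [hζ.1, hi])])

theorem isIsoOn_viaEmbedding {p : ℕ+ ↪ ℕ+} (hp : StrictMono p) {ξ ζ : Equiv.Perm ℕ+}
    (hζ : isPhi p ξ ζ) :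
    IsIsoOn (fun θ => Equiv.Perm.viaEmbedding θ p) (intrinsicInterval ξ) (intrinsicLE ξ)
      (intrinsicInterval ζ) (intrinsicLE ζ) := by
  refine ⟨⟨fun θ hθ => ?_, fun θ _ θ' _ e => ?_, fun η hη => ?_⟩, fun θ θ' _ _ => ?_⟩
  · exact (mem_intrinsicInterval_iff_of_isPhi hp hζ (isPhi_viaEmbedding p θ)).1 hθ
  · refine Equiv.ext fun i => p.injective ?_
    rw [← (isPhi_viaEmbedding p θ).1, ← (isPhi_viaEmbedding p θ').1]
    exact congrArg (fun f : Equiv.Perm ℕ+ => f (p i)) e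
  · obtain ⟨θ, hθ⟩ := exists_isPhi p.injective fun x hx => hη.2.2 x (hζ.2 x hx)
    exact ⟨θ, (mem_intrinsicInterval_iff_of_isPhi hp hζ hθ).2 hη,
      isPhi_unique (isPhi_viaEmbedding p θ) hθ⟩
  · exact intrinsicLE_iff_of_isPhi hp hζ (isPhi_viaEmbedding p θ) (isPhi_viaEmbedding p θ')

/-- Theorem B(i): if `u ≤_k w`, `x ≤_l z` and `w∘u⁻¹` is shape equivalent to
`z∘x⁻¹`, then `[u,w]_k ≅ [x,z]_l` as posets; if moreover `w∘u⁻¹ = z∘x⁻¹`, the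
isomorphism is `v ↦ v∘u⁻¹∘x`. -/
theorem stmt13 (k l : ℕ) (hk : 0 < k) (hl : 0 < l)
    (u w x z : Equiv.Perm ℕ+)
    (hu : finSupp u) (hw : finSupp w) (hx : finSupp x) (hz : finSupp z)
    (huw : kBruhatLE k u w) (hxz : kBruhatLE l x z)
    (hshape : ∃ (ξ : Equiv.Perm ℕ+) (p q : ℕ+ → ℕ+), finSupp ξ ∧
      StrictMono p ∧ StrictMono q ∧ isPhi p ξ (w * u⁻¹) ∧ isPhi q ξ (z * x⁻¹)) :
    (∃ Φ : Equiv.Perm ℕ+ → Equiv.Perm ℕ+,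
      Set.BijOn Φ {v | kBruhatLE k u v ∧ kBruhatLE k v w}
        {v | kBruhatLE l x v ∧ kBruhatLE l v z} ∧
      ∀ v v' : Equiv.Perm ℕ+,
        (kBruhatLE k u v ∧ kBruhatLE k v w) → (kBruhatLE k u v' ∧ kBruhatLE k v' w) →
        (kBruhatLE k v v' ↔ kBruhatLE l (Φ v) (Φ v'))) ∧
    (w * u⁻¹ = z * x⁻¹ →
      Set.BijOn (fun v => v * u⁻¹ * x) {v | kBruhatLE k u v ∧ kBruhatLE k v w}
        {v | kBruhatLE l x v ∧ kBruhatLE l v z} ∧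
      ∀ v v' : Equiv.Perm ℕ+,
        (kBruhatLE k u v ∧ kBruhatLE k v w) → (kBruhatLE k u v' ∧ kBruhatLE k v' w) →
        (kBruhatLE k v v' ↔ kBruhatLE l (v * u⁻¹ * x) (v' * u⁻¹ * x))) := by
 
  have hU := isIsoOn_mul_inv hu huw
  have hX := isIsoOn_bruhatInterval hx hxz
  refine ⟨?_, fun e => ?_⟩
  · obtain ⟨ξ, p, q, -, hp, hq, hpξ, hqξ⟩ := hshape
    obtain ⟨g, hg⟩ := (isIsoOn_viaEmbedding (p := ⟨p, hp.injective⟩) hp hpξ).exists_inv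
    have hQ := isIsoOn_viaEmbedding (p := ⟨q, hq.injective⟩) hq hqξ
    exact ⟨_, hX.comp (hQ.comp (hg.comp hU))⟩
  · rw [e] at hU
    exact hX.comp hU
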